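/- arXiv:0802.4270 — 2 statements merged into one kernel-verified Lean document; each statement's English description precedes it below -/
import Mathlib

section
/- If an additive subgroup C ≤ F_q^{2n} defines a subsystem code with parameters [[n,k,r,d]]_q where k > 0 and 0 ≤ r < k, then there exists an additive subgroup C' ≤ F_q^{2(n+1)} defining a subsystem code with parameters [[n+1, k, r, d']]_q with d' ≥ d that is pure to 1. -/
open Matrix
open scoped Classical

/-- The symplectic vector space `F_q^{2n}`: pairs `(x|y)` with `x, y ∈ F_q^n`. -/
abbrev SV (F : Type*) (n : ℕ) := (Fin n → F) × (Fin n → F)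

/-- The symplectic weight `swt(x|y) = #{i : (x_i, y_i) ≠ (0,0)}`. -/
noncomputable def swt {F : Type*} [Zero F] {n : ℕ} (v : SV F n) : ℕ :=
  Nat.card {i : Fin n // v.1 i ≠ 0 ∨ v.2 i ≠ 0}

/-- minimum symplectic weight of a nonzero element of a set -/
noncomputable def swtSet {F : Type*} [Zero F] {n : ℕ} (S : Set (SV F n)) : ℕ :=
  sInf (swt '' {v | v ∈ S ∧ v ≠ 0})

/-- The trace-symplectic form `⟨u|v⟩ₛ = Tr_{q/p}(v₁·u₂ − u₁·v₂)`. -/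
noncomputable def trSymp (p : ℕ) {F : Type*} [Field F] [Fintype F] [CharP F p] {n : ℕ}
    (u v : SV F n) : ZMod p :=
  letI := ZMod.algebra F p
  Algebra.trace (ZMod p) F (dotProduct v.1 u.2 - dotProduct u.1 v.2)

/-- The trace-symplectic dual of a subset of `F_q^{2n}`. -/
def sdual (p : ℕ) {F : Type*} [Field F] [Fintype F] [CharP F p] {n : ℕ}
    (S : Set (SV F n)) : Set (SV F n) :=
  {v | ∀ w ∈ S, trSymp p v w = 0}

/-- `C` defines a subsystem code with parameters `((n,K,R,d))_q`, where
`K = q^n/(|C||D|)^{1/2}`, `R = (|C|/|D|)^{1/2}` for `D = C ∩ C^⊥s`, and `d` is the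
symplectic weight of `D^⊥s \ C` (resp. of `D^⊥s` if `D^⊥s = C`). -/
def IsSubsystemCode (p : ℕ) {F : Type*} [Field F] [Fintype F] [CharP F p] {n : ℕ}
    (K R d : ℕ) (C : AddSubgroup (SV F n)) : Prop :=
  C ≠ ⊥ ∧
  K ^ 2 * (Nat.card C * Nat.card ↥((C : Set (SV F n)) ∩ sdual p (C : Set (SV F n)))) =
    Fintype.card F ^ (2 * n) ∧
  R ^ 2 * Nat.card ↥((C : Set (SV F n)) ∩ sdual p (C : Set (SV F n))) = Nat.card C ∧
  d = if sdual p ((C : Set (SV F n)) ∩ sdual p (C : Set (SV F n))) = (C : Set (SV F n))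
      then swtSet (sdual p ((C : Set (SV F n)) ∩ sdual p (C : Set (SV F n))))
      else swtSet (sdual p ((C : Set (SV F n)) ∩ sdual p (C : Set (SV F n))) \ (C : Set (SV F n)))

/-- The subsystem code defined by `C` is pure to `d'`, i.e. `swt(D^⊥s) ≥ d'`. -/
def PureTo (p : ℕ) {F : Type*} [Field F] [Fintype F] [CharP F p] {n : ℕ}
    (d' : ℕ) (C : AddSubgroup (SV F n)) : Prop :=
  d' ≤ swtSet (sdual p ((C : Set (SV F n)) ∩ sdual p (C : Set (SV F n))))

theorem trSymp_add_left (p : ℕ) {F : Type*} [Field F] [Fintype F] [CharP F p] {n : ℕ}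
    (u u' v : SV F n) : trSymp p (u + u') v = trSymp p u v + trSymp p u' v := by
  let := ZMod.algebra F p
  simp only [trSymp, Prod.fst_add, Prod.snd_add, dotProduct_add, add_dotProduct, ← map_add]
  congr 1
  ring

theorem trSymp_swap (p : ℕ) {F : Type*} [Field F] [Fintype F] [CharP F p] {n : ℕ}
    (u v : SV F n) : trSymp p v u = -trSymp p u v := by
  let := ZMod.algebra F p
  simp only [trSymp, ← map_neg, neg_sub]

theorem trSymp_add_right (p : ℕ) {F : Type*} [Field F] [Fintype F] [CharP F p] {n : ℕ}
    (u v v' : SV F n) : trSymp p u (v + v') = trSymp p u v + trSymp p u v' := by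
  rw [trSymp_swap p (v + v') u, trSymp_add_left, trSymp_swap p v u, trSymp_swap p v' u, neg_add]

theorem trSymp_zero_left (p : ℕ) {F : Type*} [Field F] [Fintype F] [CharP F p] {n : ℕ}
    (v : SV F n) : trSymp p 0 v = 0 := by
  simpa using trSymp_add_left p 0 0 v

theorem trSymp_zero_right (p : ℕ) {F : Type*} [Field F] [Fintype F] [CharP F p] {n : ℕ}
    (u : SV F n) : trSymp p u 0 = 0 := by
  simpa using trSymp_add_right p u 0 0

/-- The trace-symplectic form as a biadditive map. -/
noncomputable def trSympHom (p : ℕ) (F : Type*) [Field F] [Fintype F] [CharP F p] (n : ℕ) :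
    SV F n →+ SV F n →+ ZMod p :=
  AddMonoidHom.mk' (fun u => AddMonoidHom.mk' (trSymp p u) (trSymp_add_right p u))
    fun u u' => AddMonoidHom.ext (trSymp_add_left p u u')

/-- The trace-symplectic dual of an additive subgroup, as an additive subgroup. -/
noncomputable def sdualSubgroup (p : ℕ) {F : Type*} [Field F] [Fintype F] [CharP F p] {n : ℕ}
    (D : AddSubgroup (SV F n)) : AddSubgroup (SV F n) :=
  ((AddMonoidHom.compHom' D.subtype).comp (trSympHom p F n)).ker

theorem coe_sdualSubgroup (p : ℕ) {F : Type*} [Field F] [Fintype F] [CharP F p] {n : ℕ}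
    (D : AddSubgroup (SV F n)) : (sdualSubgroup p D : Set (SV F n)) = sdual p (D : Set (SV F n)) := by
  ext v
  simp [sdualSubgroup, sdual, AddMonoidHom.ext_iff, trSympHom]

/-- An elementary abelian `p`-group has as many characters to `ZMod p` as elements. -/
theorem natCard_addMonoidHom_zmod {p : ℕ} [Fact p.Prime] (M : Type*) [AddCommGroup M] [Finite M]
    [Module (ZMod p) M] : Nat.card (M →+ ZMod p) = Nat.card M := by
  rw [Nat.card_congr (AddMonoidHom.toZModLinearMapEquiv p (M := M) (M₁ := ZMod p)).toEquiv]
  change Nat.card (Module.Dual (ZMod p) M) = Nat.card M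
  rw [Module.natCard_eq_pow_finrank (K := ZMod p), Module.natCard_eq_pow_finrank (K := ZMod p) (V := M),
    Subspace.dual_finrank_eq]

theorem natCard_le_natCard_mul_natCard_sdual (p : ℕ) [Fact p.Prime] {F : Type*} [Field F]
    [Fintype F] [CharP F p] {n : ℕ} (D : AddSubgroup (SV F n)) :
    Fintype.card F ^ (2 * n) ≤ Nat.card D * Nat.card (sdual p (D : Set (SV F n))) := by
  let := ZMod.algebra F p
  let f := (AddMonoidHom.compHom' D.subtype).comp (trSympHom p F n)
  have hV : Nat.card (SV F n) = Fintype.card F ^ (2 * n) := by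
    simp [two_mul, pow_add]
  let : Module (ZMod p) D := inferInstanceAs (Module (ZMod p) (AddSubgroup.toZModSubmodule p D))
  have hD : Nat.card (D →+ ZMod p) = Nat.card D := natCard_addMonoidHom_zmod D
  have : Finite (D →+ ZMod p) := Finite.of_injective _ DFunLike.coe_injective
  have hker : Nat.card f.ker = Nat.card (sdual p (D : Set (SV F n))) := by
    rw [← coe_sdualSubgroup]; rfl
  rw [← hV, ← AddSubgroup.card_mul_index f.ker, AddSubgroup.index_ker, hker, mul_comm, ← hD]
  exact Nat.mul_le_mul_right _ (Nat.card_le_card_of_injective _ Subtype.val_injective)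

/-- Deletion of the last coordinate pair. -/
def svInit {F : Type*} {n : ℕ} (v : SV F (n + 1)) : SV F n :=
  (Fin.init v.1, Fin.init v.2)

/-- The vectors `(x, a | y, 0)` with `(x | y) ∈ S` and `a` arbitrary. -/
def extendSet {F : Type*} [Zero F] {n : ℕ} (S : Set (SV F n)) : Set (SV F (n + 1)) :=
  {v | svInit v ∈ S ∧ v.2 (Fin.last n) = 0}

/-- The vector `(x, a | y, 0)` obtained from `(x | y)` and `a`. -/
def svSnoc {F : Type*} [Zero F] {n : ℕ} (v : SV F n) (a : F) : SV F (n + 1) :=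
  (Fin.snoc v.1 a, Fin.snoc v.2 0)

theorem svInit_svSnoc {F : Type*} [Zero F] {n : ℕ} (v : SV F n) (a : F) :
    svInit (svSnoc v a) = v := by
  simp [svInit, svSnoc]

theorem svSnoc_mem_extendSet {F : Type*} [Zero F] {n : ℕ} {S : Set (SV F n)} {v : SV F n} {a : F} :
    svSnoc v a ∈ extendSet S ↔ v ∈ S := by
  change svInit (svSnoc v a) ∈ S ∧ (Fin.snoc v.2 0 : Fin (n + 1) → F) (Fin.last n) = 0 ↔ v ∈ S
  simp [svInit_svSnoc]

theorem svSnoc_svInit {F : Type*} [Zero F] {n : ℕ} {v : SV F (n + 1)} (h : v.2 (Fin.last n) = 0) :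
    svSnoc (svInit v) (v.1 (Fin.last n)) = v := by
  refine Prod.ext (Fin.snoc_init_self _) ?_
  simp only [svSnoc, svInit, ← h, Fin.snoc_init_self]

theorem extendSet_injective {F : Type*} [Zero F] {n : ℕ} :
    Function.Injective (extendSet : Set (SV F n) → Set (SV F (n + 1))) := fun S T h => by
  ext v
  rw [← svSnoc_mem_extendSet (a := 0), h, svSnoc_mem_extendSet]

theorem extendSet_inter {F : Type*} [Zero F] {n : ℕ} (S T : Set (SV F n)) :
    extendSet S ∩ extendSet T = extendSet (S ∩ T) := by
  ext v
  simp only [extendSet, Set.mem_inter_iff, Set.mem_ofPred_eq]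
  tauto

theorem extendSet_diff {F : Type*} [Zero F] {n : ℕ} (S T : Set (SV F n)) :
    extendSet S \ extendSet T = extendSet (S \ T) := by
  ext v
  simp only [extendSet, Set.mem_sdiff, Set.mem_ofPred_eq]
  tauto

theorem natCard_extendSet {F : Type*} [Zero F] [Fintype F] {n : ℕ} (S : Set (SV F n)) :
    Nat.card (extendSet S) = Nat.card S * Fintype.card F := by
  rw [← Nat.card_eq_fintype_card, ← Nat.card_prod]
  exact Nat.card_congr
    { toFun := fun v => (⟨svInit v.1, v.2.1⟩, v.1.1 (Fin.last n))
      invFun := fun w => ⟨svSnoc w.1.1 w.2, svSnoc_mem_extendSet.2 w.1.2⟩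
      left_inv := fun v => Subtype.ext (svSnoc_svInit v.2.2)
      right_inv := fun w =>
        Prod.ext (Subtype.ext (svInit_svSnoc _ _)) (by simp [svSnoc]) }

theorem trSymp_succ (p : ℕ) {F : Type*} [Field F] [Fintype F] [CharP F p] {n : ℕ}
    (u v : SV F (n + 1)) :
    letI := ZMod.algebra F p
    trSymp p u v = trSymp p (svInit u) (svInit v) + Algebra.trace (ZMod p) F
      (v.1 (Fin.last n) * u.2 (Fin.last n) - u.1 (Fin.last n) * v.2 (Fin.last n)) := by
  simp only [trSymp, ← map_add]
  congr 1
  simp only [dotProduct, Fin.sum_univ_castSucc, svInit, Fin.init]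
  ring

theorem sdual_extendSet (p : ℕ) [Fact p.Prime] {F : Type*} [Field F] [Fintype F] [CharP F p]
    {n : ℕ} {S : Set (SV F n)} (h0 : 0 ∈ S) :
    sdual p (extendSet S) = extendSet (sdual p S) := by
  let := ZMod.algebra F p
  ext v
  constructor
  · intro hv
    have hlast : v.2 (Fin.last n) = 0 := by
      by_contra hne
      refine hne ((traceForm_nondegenerate (ZMod p) F).1 _ fun b => ?_)
      have := hv (svSnoc 0 b) (svSnoc_mem_extendSet.2 h0)
      rw [trSymp_succ, svInit_svSnoc, trSymp_zero_right] at this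
      simpa [svSnoc, mul_comm, Algebra.traceForm_apply] using this
    refine ⟨fun w hw => ?_, hlast⟩
    have := hv (svSnoc w 0) (svSnoc_mem_extendSet.2 hw)
    rw [trSymp_succ, svInit_svSnoc] at this
    simpa [svSnoc] using this
  · rintro ⟨hv, hlast⟩ w ⟨hw, hwlast⟩
    rw [trSymp_succ, hv _ hw, hlast, hwlast]
    simp

theorem swt_svInit_le {F : Type*} [Zero F] {n : ℕ} (v : SV F (n + 1)) :
    swt (svInit v) ≤ swt v :=
  Nat.card_le_card_of_injective (fun i => ⟨i.1.castSucc, i.2⟩) fun _ _ h =>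
    Subtype.ext (Fin.castSucc_injective n (congrArg Subtype.val h))

theorem swt_pos {F : Type*} [Zero F] {n : ℕ} {v : SV F n} (hv : v ≠ 0) : 1 ≤ swt v := by
  by_contra hlt
  have : IsEmpty {i : Fin n // v.1 i ≠ 0 ∨ v.2 i ≠ 0} := by
    rcases Nat.card_eq_zero.1 (Nat.lt_one_iff.1 (not_le.1 hlt)) with h | h
    · exact h
    · exact absurd h (not_infinite_iff_finite.2 inferInstance)
  have key : ∀ i, v.1 i = 0 ∧ v.2 i = 0 := fun i => by
    by_contra hi
    exact this.false ⟨i, by tauto⟩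
  exact hv (Prod.ext (funext fun i => (key i).1) (funext fun i => (key i).2))

theorem le_swtSet {F : Type*} [Zero F] {n m : ℕ} {S : Set (SV F n)} (hne : ∃ v ∈ S, v ≠ 0)
    (h : ∀ v ∈ S, v ≠ 0 → m ≤ swt v) : m ≤ swtSet S := by
  obtain ⟨v, hv⟩ := hne
  refine le_csInf ⟨_, v, hv, rfl⟩ ?_
  rintro _ ⟨w, hw, rfl⟩
  exact h w hw.1 hw.2

theorem swtSet_le_swtSet_extendSet {F : Type*} [Zero F] {n : ℕ} {S : Set (SV F n)}
    (h0 : 0 ∉ S) (hne : S.Nonempty) : swtSet S ≤ swtSet (extendSet S) := by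
  obtain ⟨w, hw⟩ := hne
  have hz : svInit (0 : SV F (n + 1)) = 0 := rfl
  refine le_swtSet ⟨svSnoc w 0, svSnoc_mem_extendSet.2 hw, fun h => h0 ?_⟩ fun v hv _ => ?_
  · rw [← hz, ← h, svInit_svSnoc]
    exact hw
  · have hmem : swt (svInit v) ∈ swt '' {v | v ∈ S ∧ v ≠ 0} :=
      ⟨svInit v, ⟨hv.1, fun h => h0 (h ▸ hv.1)⟩, rfl⟩
    exact (Nat.sInf_le hmem).trans (swt_svInit_le v)

/-- The additive subgroup `C ⊕ {(a | 0)}`. -/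
def extendSubgroup {F : Type*} [AddGroup F] {n : ℕ} (C : AddSubgroup (SV F n)) :
    AddSubgroup (SV F (n + 1)) where
  carrier := extendSet C
  zero_mem' := ⟨C.zero_mem, rfl⟩
  add_mem' := fun {u v} hu hv => ⟨C.add_mem hu.1 hv.1, by simp [hu.2, hv.2]⟩
  neg_mem' := fun {u} hu => ⟨C.neg_mem hu.1, by simp [hu.2]⟩

/-- Extending a subsystem code: an `[[n,k,r,d]]_q` subsystem code with `k > 0`, `0 ≤ r < k`
yields an `[[n+1,k,r,≥d]]_q` subsystem code that is pure to 1. -/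
theorem stmt2 {p : ℕ} [Fact p.Prime] {F : Type} [Field F] [Fintype F] [CharP F p]
    {n k r d : ℕ} (C : AddSubgroup (SV F n))
    (h : IsSubsystemCode p (Fintype.card F ^ k) (Fintype.card F ^ r) d C)
    (hk : 0 < k) (hr : r < k) :
    ∃ (C' : AddSubgroup (SV F (n + 1))) (d' : ℕ),
      d ≤ d' ∧ IsSubsystemCode p (Fintype.card F ^ k) (Fintype.card F ^ r) d' C' ∧
        PureTo p 1 C' := by
  set D := (C : Set (SV F n)) ∩ sdual p (C : Set (SV F n)) with hD
  have h0 : (0 : SV F n) ∈ D := ⟨C.zero_mem, fun w _ => trSymp_zero_left p w⟩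
  have hC' : ((extendSubgroup C : AddSubgroup _) : Set (SV F (n + 1))) = extendSet C := rfl
  have hD' : (extendSet (C : Set (SV F n))) ∩ sdual p (extendSet (C : Set (SV F n))) =
      extendSet D := by
    rw [sdual_extendSet p C.zero_mem, extendSet_inter]
  have hcardC : Nat.card (extendSubgroup C) = Nat.card C * Fintype.card F :=
    natCard_extendSet (C : Set (SV F n))
  have hcardD : Nat.card (extendSet D) = Nat.card D * Fintype.card F := natCard_extendSet D
  obtain ⟨-, hK, hR, hd⟩ := h
  rw [← hD] at hK hR hd
  have hsub : (C : Set (SV F n)) ⊆ sdual p D := fun v hv w hw => by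
    rw [trSymp_swap, hw.2 v hv, neg_zero]
  have hne : sdual p D ≠ C := fun heq => by
    have hcard : Fintype.card F ^ (2 * n) ≤ Nat.card D * Nat.card C := by
      have := natCard_le_natCard_mul_natCard_sdual p (C ⊓ sdualSubgroup p C)
      rw [AddSubgroup.coe_inf, coe_sdualSubgroup, ← hD, heq] at this
      rw [hD, ← coe_sdualSubgroup]
      exact this
    have hpos : 0 < Fintype.card F ^ (2 * n) := pow_pos Fintype.card_pos _
    have hq : 1 < (Fintype.card F ^ k) ^ 2 :=
      Nat.one_lt_pow two_ne_zero (Nat.one_lt_pow hk.ne' Fintype.one_lt_card)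
    nlinarith
  have hne' : sdual p (extendSet D) ≠ extendSet C := by
    rw [sdual_extendSet p h0]
    exact extendSet_injective.ne hne
  have hsnoc : svSnoc (0 : SV F n) 1 ≠ 0 := fun h => by
    simpa [svSnoc] using congrFun (congrArg Prod.fst h) (Fin.last n)
  rw [if_neg hne] at hd
  refine ⟨extendSubgroup C, swtSet (extendSet (sdual p D \ C)), ?_, ⟨?_, ?_, ?_, ?_⟩, ?_⟩
  · rw [hd]
    exact swtSet_le_swtSet_extendSet (fun h => h.2 C.zero_mem)
      (Set.sdiff_nonempty.2 fun h => hne (h.antisymm hsub))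
  · intro h
    have : svSnoc (0 : SV F n) 1 ∈ extendSubgroup C := svSnoc_mem_extendSet.2 C.zero_mem
    rw [h] at this
    exact hsnoc this
  · rw [hC', hD', hcardC, hcardD, mul_add, pow_add, ← hK]
    ring
  · rw [hC', hD', hcardC, hcardD, ← hR]
    ring
  · rw [hC', hD', if_neg hne', sdual_extendSet p h0, extendSet_diff]
  · rw [PureTo, hC', hD', sdual_extendSet p h0]
    exact le_swtSet ⟨_, svSnoc_mem_extendSet.2 fun w _ => trSymp_zero_left p w, hsnoc⟩
      fun v _ hv => swt_pos hv
end

section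
/- Let C_1, C_2 ≤ F_q^{2n} be additive subgroups with D_i = C_i ∩ C_i^⊥s defining pure subsystem codes with parameters [[n,k_1,r_1,d_1]]_q and [[n,k_2,r_2,d_2]]_q respectively, and suppose D_1 ⊆ D_2 (so that the second code is a subcode of the first). Then there exists an additive subgroup of F_q^{4n} defining a pure subsystem code with parameters [[2n, k_1+k_2, r_1+r_2, d]]_q where d ≥ min{d_1, 2d_2}. -/
open Matrix
open scoped Classical

section SymplecticReduction

open LinearMap.BilinForm

variable {K V : Type*} [Field K] [AddCommGroup V] [Module K V] [FiniteDimensional K V]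

/-- Splitting off a hyperbolic plane containing a vector outside the radical. -/
theorem exists_hyperplane_pair_inf_orthogonal_eq {B : LinearMap.BilinForm K V} (hB : B.IsAlt)
    {W : Submodule K V} {w : V} (hw : w ∈ W) (hw' : w ∉ W ⊓ B.orthogonal W) :
    ∃ W' ≤ W, w ∉ W' ∧ Module.finrank K W' + 2 = Module.finrank K W ∧
      W' ⊓ B.orthogonal W' = W ⊓ B.orthogonal W := by
  obtain ⟨x, hx, hxw⟩ : ∃ x ∈ W, B x w ≠ 0 := by
    by_contra! h
    exact hw' ⟨hw, h⟩
  set f : W →ₗ[K] K × K := ((B x).prod (B w)).comp W.subtype with hf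
  have hwx : B w x = -B x w := (hB.neg_eq x w).symm
  have hf1 : ∀ z : W, f z = (B x z, B w z) := fun z => rfl
  have hsurj : Function.Surjective f := by
    rintro ⟨s, t⟩
    refine ⟨((B x w)⁻¹ * s) • ⟨w, hw⟩ - ((B x w)⁻¹ * t) • ⟨x, hx⟩, ?_⟩
    rw [hf1]
    simp [hB.self_eq_zero, hwx]
    constructor <;> field_simp
  have hmem : ∀ z, z ∈ (LinearMap.ker f).map W.subtype ↔ z ∈ W ∧ B x z = 0 ∧ B w z = 0 := by
    intro z
    simp only [Submodule.mem_map, LinearMap.mem_ker, hf1, Prod.mk_eq_zero]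
    exact ⟨by rintro ⟨y, h, rfl⟩; exact ⟨y.2, h⟩, fun h => ⟨⟨z, h.1⟩, h.2, rfl⟩⟩
  refine ⟨(LinearMap.ker f).map W.subtype, Submodule.map_subtype_le _ _, ?_, ?_, ?_⟩
  · rw [hmem]
    exact fun h => hxw h.2.1
  · rw [Submodule.finrank_map_subtype_eq, ← LinearMap.finrank_range_add_finrank_ker f,
      LinearMap.range_eq_top.2 hsurj, finrank_top, Module.finrank_prod, Module.finrank_self]
    ring
  · ext z
    simp only [Submodule.mem_inf, hmem, mem_orthogonal_iff]
    constructor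
    · rintro ⟨⟨hz, hxz, hwz⟩, h⟩
      refine ⟨hz, fun y hy => ?_⟩
      have := h (y - ((B x w)⁻¹ * B x y) • w + ((B x w)⁻¹ * B w y) • x)
        ⟨W.add_mem (W.sub_mem hy (W.smul_mem _ hw)) (W.smul_mem _ hx), by
          simp [hB.self_eq_zero]; field_simp; simp, by
          simp [hB.self_eq_zero, hwx]; field_simp; simp⟩
      simpa [hxz, hwz] using this
    · rintro ⟨hz, h⟩
      exact ⟨⟨hz, h x hx, h w hw⟩, fun y hy => h y hy.1⟩

theorem exists_submodule_inf_orthogonal_eq {B : LinearMap.BilinForm K V} (hB : B.IsAlt)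
    {W : Submodule K V} {w : V} (hw : w ∉ W ⊓ B.orthogonal W) (j : ℕ)
    (hj : Module.finrank K ↥(W ⊓ B.orthogonal W) + 2 * j ≤ Module.finrank K W) :
    ∃ W' ≤ W, (0 < j → w ∉ W') ∧ Module.finrank K W' + 2 * j = Module.finrank K W ∧
      W' ⊓ B.orthogonal W' = W ⊓ B.orthogonal W := by
  induction j with
  | zero => exact ⟨W, le_rfl, by simp, by simp, rfl⟩
  | succ j ih =>
    obtain ⟨W', hle, -, hrank, hrad⟩ := ih (by omega)
    by_cases hwW : w ∈ W'
    · obtain ⟨W'', hle', hw', hrank', hrad'⟩ :=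
        exists_hyperplane_pair_inf_orthogonal_eq hB hwW (hrad ▸ hw)
      exact ⟨W'', hle'.trans hle, fun _ => hw', by omega, hrad'.trans hrad⟩
    · obtain ⟨v, hv, hv'⟩ : ∃ v ∈ W', v ∉ W' ⊓ B.orthogonal W' := by
        by_contra! h
        have := Submodule.finrank_mono (show W' ≤ W' ⊓ B.orthogonal W' from h)
        rw [hrad] at this
        omega
      obtain ⟨W'', hle', -, hrank', hrad'⟩ :=
        exists_hyperplane_pair_inf_orthogonal_eq hB hv hv'
      exact ⟨W'', hle'.trans hle, fun _ h => hwW (hle' h), by omega, hrad'.trans hrad⟩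

end SymplecticReduction

section Weight

variable {F : Type*} {n : ℕ}

theorem swtSet_le [Zero F] {S : Set (SV F n)} {v : SV F n} (hv : v ∈ S) (hv0 : v ≠ 0) :
    swtSet S ≤ swt v :=
  Nat.sInf_le ⟨v, ⟨hv, hv0⟩, rfl⟩

theorem exists_swt_eq_swtSet [Zero F] {S : Set (SV F n)} (hS : ∃ v ∈ S, v ≠ 0) :
    ∃ v ∈ S, v ≠ 0 ∧ swt v = swtSet S := by
  obtain ⟨v, hv, hv0⟩ := hS
  obtain ⟨u, hu, h⟩ := Nat.sInf_mem (s := swt '' {v | v ∈ S ∧ v ≠ 0}) ⟨_, v, ⟨hv, hv0⟩, rfl⟩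
  exact ⟨u, hu.1, hu.2, h⟩

theorem swt_zero [Zero F] : swt (0 : SV F n) = 0 := by
  simp [swt]

theorem swt_sub_le [AddGroup F] (u v : SV F n) : swt (u - v) ≤ swt u + swt v := by
  simp only [swt, Nat.card_eq_fintype_card, Fintype.card_subtype]
  refine le_trans (Finset.card_le_card ?_) (Finset.card_union_le _ _)
  intro i
  simp only [Finset.mem_filter, Finset.mem_union, Finset.mem_univ, true_and, Prod.fst_sub,
    Prod.snd_sub, Pi.sub_apply]
  contrapose!
  rintro ⟨⟨h1, h2⟩, h3, h4⟩
  simp [h1, h2, h3, h4]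

end Weight

section TraceSymplectic

attribute [local instance] ZMod.algebra

variable {p : ℕ} [Fact p.Prime] {F : Type} [Field F] [CharP F p] {n : ℕ}

/-- The index splitting underlying the concatenation of two vectors. -/
def finDouble (n : ℕ) : Fin n ⊕ Fin n ≃ Fin (2 * n) :=
  finSumFinEquiv.trans (finCongr (two_mul n).symm)

variable (p F n) in
/-- Concatenation of two vectors of length `n`. -/
def joinSV : (SV F n × SV F n) ≃ₗ[ZMod p] SV F (2 * n) where
  toFun v := (Sum.elim v.1.1 v.2.1 ∘ (finDouble n).symm, Sum.elim v.1.2 v.2.2 ∘ (finDouble n).symm)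
  invFun v := ((v.1 ∘ finDouble n ∘ Sum.inl, v.2 ∘ finDouble n ∘ Sum.inl),
    (v.1 ∘ finDouble n ∘ Sum.inr, v.2 ∘ finDouble n ∘ Sum.inr))
  map_add' u v := by
    ext i <;> obtain ⟨i | i, rfl⟩ := (finDouble n).surjective i <;> simp
  map_smul' c v := by
    ext i <;> obtain ⟨i | i, rfl⟩ := (finDouble n).surjective i <;> simp
  left_inv v := by
    ext i <;> simp
  right_inv v := by
    ext i <;> obtain ⟨i | i, rfl⟩ := (finDouble n).surjective i <;> simp

theorem swt_joinSV (a b : SV F n) : swt (joinSV p F n (a, b)) = swt a + swt b := by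
  rw [swt, swt, swt, ← Nat.card_sum]
  refine Nat.card_congr (Equiv.trans ?_ (Equiv.subtypeSum (p := fun i =>
    Sum.elim a.1 b.1 i ≠ 0 ∨ Sum.elim a.2 b.2 i ≠ 0)))
  exact (finDouble n).symm.subtypeEquiv fun i => Iff.rfl

/-- In a pure code with a nontrivial logical subsystem, the minimum weight of the dual of the
stabilizer is attained outside the gauge group. -/
theorem exists_swt_eq_of_pure {E W : Submodule (ZMod p) (SV F n)} (hWE : W ≤ E) {d : ℕ}
    (hne : E ≠ W)
    (hd : d = if E = W then swtSet (E : Set (SV F n)) else swtSet ((E : Set (SV F n)) \ W)) :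
    ∃ v ∈ E, v ∉ W ∧ v ≠ 0 ∧ swt v = d := by
  rw [if_neg hne] at hd
  obtain ⟨v, hv, hvW⟩ := SetLike.exists_of_lt (lt_of_le_of_ne hWE hne.symm)
  obtain ⟨u, hu, hu0, h⟩ := exists_swt_eq_swtSet
    ⟨v, (Set.mem_sdiff _).2 ⟨hv, hvW⟩, fun h => hvW (h ▸ W.zero_mem)⟩
  exact ⟨u, hu.1, hu.2, hu0, h.trans hd.symm⟩

theorem eq_swtSet_of_pure {E W : Submodule (ZMod p) (SV F n)} (hWE : W ≤ E) {d : ℕ}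
    (hd : d = if E = W then swtSet (E : Set (SV F n)) else swtSet ((E : Set (SV F n)) \ W))
    (hpure : d ≤ swtSet (E : Set (SV F n))) : d = swtSet (E : Set (SV F n)) := by
  by_cases hne : E = W
  · rw [hd, if_pos hne]
  · obtain ⟨v, hv, -, hv0, h⟩ := exists_swt_eq_of_pure hWE hne hd
    exact le_antisymm hpure (h ▸ swtSet_le hv hv0)

variable (p F n) in
/-- The map `(a, b) ↦ (a - b | b)`. -/
def shearJoin : (SV F n × SV F n) ≃ₗ[ZMod p] SV F (2 * n) :=
  LinearEquiv.trans
    { toFun := fun v => (v.1 - v.2, v.2)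
      invFun := fun v => (v.1 + v.2, v.2)
      map_add' := fun u v => by ext <;> simp <;> ring
      map_smul' := fun c v => by ext <;> simp [smul_sub]
      left_inv := fun v => by simp
      right_inv := fun v => by simp }
    (joinSV p F n)

theorem shearJoin_apply (a b : SV F n) :
    shearJoin p F n (a, b) = joinSV p F n (a - b, b) := rfl

/-- The stabilizer of the `(u | u + v)` construction. -/
def joinStabilizer (D₁ D₂ : Submodule (ZMod p) (SV F n)) : Submodule (ZMod p) (SV F (2 * n)) :=
  (D₂.prod D₁).map (shearJoin p F n).toLinearMap

theorem joinSV_mem_joinStabilizer {D₁ D₂ : Submodule (ZMod p) (SV F n)} {x y : SV F n} :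
    joinSV p F n (x, y) ∈ joinStabilizer D₁ D₂ ↔ x + y ∈ D₂ ∧ y ∈ D₁ := by
  have h : joinSV p F n (x, y) = shearJoin p F n (x + y, y) := by
    rw [shearJoin_apply, add_sub_cancel_right]
  rw [h, joinStabilizer]
  exact (Submodule.mem_map_equiv _).trans (by simp)

variable [Fintype F]

variable (p F n) in
/-- The trace-symplectic form as a bilinear form over the prime field. -/
noncomputable def trSympForm : LinearMap.BilinForm (ZMod p) (SV F n) :=
  LinearMap.mk₂ (ZMod p) (trSymp p)
    (fun u u' v => by simp [trSymp, add_dotProduct, dotProduct_add]; ring)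
    (fun c u v => by simp [trSymp, smul_dotProduct, dotProduct_smul, mul_sub])
    (fun u v v' => by simp [trSymp, add_dotProduct, dotProduct_add]; ring)
    (fun c u v => by simp [trSymp, smul_dotProduct, dotProduct_smul, mul_sub])

@[simp]
theorem trSympForm_apply (u v : SV F n) : trSympForm p F n u v = trSymp p u v := rfl

theorem trSympForm_isAlt : (trSympForm p F n).IsAlt := fun u => by simp [trSymp]

theorem trSympForm_nondegenerate : (trSympForm p F n).Nondegenerate := by
  have hsep : (trSympForm p F n).SeparatingLeft := by
    intro u hu
    have key : ∀ a : F, (∀ b : F, Algebra.trace (ZMod p) F (a * b) = 0) → a = 0 := fun a ha =>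
      (traceForm_nondegenerate (ZMod p) F).1 a fun b => by
        rw [Algebra.traceForm_apply]; exact ha b
    ext i
    · refine key _ fun b => ?_
      have := hu (0, Pi.single i b)
      simpa [trSymp] using this
    · refine key _ fun b => ?_
      have := hu (Pi.single i b, 0)
      simpa [trSymp, mul_comm] using this
  exact ⟨hsep, fun u hu => hsep u fun v => by
    rw [← trSympForm_isAlt.neg_eq, hu, neg_zero]⟩

theorem coe_orthogonal_trSympForm (W : Submodule (ZMod p) (SV F n)) :
    ((trSympForm p F n).orthogonal W : Set (SV F n)) = sdual p (W : Set (SV F n)) := by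
  ext v
  simp only [SetLike.mem_coe, LinearMap.BilinForm.mem_orthogonal_iff, sdual, Set.mem_ofPred_eq]
  exact forall₂_congr fun w _ => by
    rw [trSympForm_isAlt.isRefl.eq_iff, trSympForm_apply]

theorem natCard_submodule (W : Submodule (ZMod p) (SV F n)) :
    Nat.card W = p ^ Module.finrank (ZMod p) W := by
  rw [Module.natCard_eq_pow_finrank (K := ZMod p), Nat.card_zmod]

theorem finrank_SV : Module.finrank (ZMod p) (SV F n) = 2 * n * Module.finrank (ZMod p) F := by
  rw [Module.finrank_prod, Module.finrank_pi_fintype]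
  simp
  ring

theorem trSymp_joinSV (a b c d : SV F n) :
    trSymp p (joinSV p F n (a, b)) (joinSV p F n (c, d)) = trSymp p a c + trSymp p b d := by
  have h : ∀ x y z w : Fin n → F, (Sum.elim x y ∘ (finDouble n).symm) ⬝ᵥ
      (Sum.elim z w ∘ (finDouble n).symm) = x ⬝ᵥ z + y ⬝ᵥ w := by
    intro x y z w
    rw [comp_equiv_dotProduct_comp_equiv, sumElim_dotProduct_sumElim]
  simp only [trSymp, joinSV, LinearEquiv.coe_mk, LinearMap.coe_mk, AddHom.coe_mk, h]
  rw [← map_add]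
  congr 1
  ring

theorem le_orthogonal_radical (W : Submodule (ZMod p) (SV F n)) :
    W ≤ (trSympForm p F n).orthogonal (W ⊓ (trSympForm p F n).orthogonal W) :=
  (LinearMap.BilinForm.le_orthogonal_orthogonal trSympForm_isAlt.isRefl).trans
    (LinearMap.BilinForm.orthogonal_le inf_le_right)

theorem coe_radical (W : Submodule (ZMod p) (SV F n)) :
    ((W ⊓ (trSympForm p F n).orthogonal W : Submodule (ZMod p) (SV F n)) : Set (SV F n)) =
      (W : Set (SV F n)) ∩ sdual p (W : Set (SV F n)) := by
  rw [Submodule.coe_inf, coe_orthogonal_trSympForm]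

theorem isSubsystemCode_iff {k r d : ℕ} (W : Submodule (ZMod p) (SV F n)) :
    IsSubsystemCode p (Fintype.card F ^ k) (Fintype.card F ^ r) d W.toAddSubgroup ↔
      W ≠ ⊥ ∧
      2 * (Module.finrank (ZMod p) F * k) + (Module.finrank (ZMod p) W +
        Module.finrank (ZMod p) ↥(W ⊓ (trSympForm p F n).orthogonal W)) =
          2 * (Module.finrank (ZMod p) F * n) ∧
      2 * (Module.finrank (ZMod p) F * r) +
        Module.finrank (ZMod p) ↥(W ⊓ (trSympForm p F n).orthogonal W) =
          Module.finrank (ZMod p) W ∧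
      d = if (trSympForm p F n).orthogonal (W ⊓ (trSympForm p F n).orthogonal W) = W
        then swtSet ((trSympForm p F n).orthogonal
          (W ⊓ (trSympForm p F n).orthogonal W) : Set (SV F n))
        else swtSet (((trSympForm p F n).orthogonal
          (W ⊓ (trSympForm p F n).orthogonal W) : Set (SV F n)) \ W) := by
  have hp : 1 < p := (Fact.out : p.Prime).one_lt
  have hq : Fintype.card F = p ^ Module.finrank (ZMod p) F := by
    rw [Module.card_eq_pow_finrank (K := ZMod p), ZMod.card]
  have hW : Nat.card W.toAddSubgroup = p ^ Module.finrank (ZMod p) W := natCard_submodule W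
  rw [IsSubsystemCode, Submodule.coe_toAddSubgroup, ← coe_radical, ← coe_orthogonal_trSympForm,
    SetLike.coe_sort_coe, natCard_submodule, hW, hq]
  simp only [SetLike.coe_set_eq, ← pow_mul, ← pow_add, Nat.pow_right_inj hp]
  refine and_congr (not_congr ?_) (and_congr ?_ (and_congr ?_ Iff.rfl))
  · rw [← Submodule.bot_toAddSubgroup (R := ZMod p), Submodule.toAddSubgroup_inj]
  · ring_nf
  · ring_nf

theorem pureTo_iff {d : ℕ} (W : Submodule (ZMod p) (SV F n)) :
    PureTo p d W.toAddSubgroup ↔ d ≤ swtSet ((trSympForm p F n).orthogonal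
      (W ⊓ (trSympForm p F n).orthogonal W) : Set (SV F n)) := by
  rw [PureTo, Submodule.coe_toAddSubgroup, ← coe_radical, ← coe_orthogonal_trSympForm]

theorem finrank_add_finrank_orthogonal_trSympForm (W : Submodule (ZMod p) (SV F n)) :
    Module.finrank (ZMod p) W + Module.finrank (ZMod p) ((trSympForm p F n).orthogonal W) =
      2 * (Module.finrank (ZMod p) F * n) := by
  rw [LinearMap.BilinForm.finrank_orthogonal trSympForm_nondegenerate,
    Nat.add_sub_of_le (Submodule.finrank_le W), finrank_SV]
  ring

theorem joinSV_mem_orthogonal {D₁ D₂ : Submodule (ZMod p) (SV F n)} {x y : SV F n} :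
    joinSV p F n (x, y) ∈ (trSympForm p F (2 * n)).orthogonal (joinStabilizer D₁ D₂) ↔
      x ∈ (trSympForm p F n).orthogonal D₂ ∧ y - x ∈ (trSympForm p F n).orthogonal D₁ := by
  have key : ∀ a b, trSympForm p F (2 * n) (shearJoin p F n (a, b)) (joinSV p F n (x, y)) =
      trSympForm p F n a x + trSympForm p F n b (y - x) := fun a b => by
    rw [shearJoin_apply, trSympForm_apply, trSymp_joinSV, ← trSympForm_apply, ← trSympForm_apply]
    simp only [map_sub, LinearMap.sub_apply]
    ring
  simp only [LinearMap.BilinForm.mem_orthogonal_iff]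
  constructor
  · intro h
    have h' : ∀ a ∈ D₂, ∀ b ∈ D₁, trSympForm p F n a x + trSympForm p F n b (y - x) = 0 :=
      fun a ha b hb => by
        rw [← key]
        exact h _ ⟨(a, b), ⟨ha, hb⟩, rfl⟩
    exact ⟨fun a ha => by simpa using h' a ha 0 D₁.zero_mem,
      fun b hb => by simpa using h' 0 D₂.zero_mem b hb⟩
  · rintro ⟨hx, hy⟩ _ ⟨⟨a, b⟩, ⟨ha, hb⟩, rfl⟩
    exact (key a b).trans (by rw [hx a ha, hy b hb, add_zero])

theorem finrank_joinStabilizer (D₁ D₂ : Submodule (ZMod p) (SV F n)) :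
    Module.finrank (ZMod p) (joinStabilizer D₁ D₂) =
      Module.finrank (ZMod p) D₂ + Module.finrank (ZMod p) D₁ := by
  rw [joinStabilizer, LinearEquiv.finrank_map_eq, ← Module.finrank_prod]
  exact LinearEquiv.finrank_eq
    { toFun := fun z => (⟨z.1.1, z.2.1⟩, ⟨z.1.2, z.2.2⟩)
      invFun := fun z => ⟨(z.1, z.2), z.1.2, z.2.2⟩
      map_add' := fun _ _ => rfl
      map_smul' := fun _ _ => rfl
      left_inv := fun _ => rfl
      right_inv := fun _ => rfl }

theorem joinStabilizer_le_orthogonal {D₁ D₂ : Submodule (ZMod p) (SV F n)} (h : D₁ ≤ D₂)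
    (h₂ : D₂ ≤ (trSympForm p F n).orthogonal D₂) :
    joinStabilizer D₁ D₂ ≤ (trSympForm p F (2 * n)).orthogonal (joinStabilizer D₁ D₂) := by
  rintro z hz
  obtain ⟨⟨x, y⟩, rfl⟩ := (joinSV p F n).surjective z
  obtain ⟨hxy, hy⟩ := joinSV_mem_joinStabilizer.1 hz
  have hx : x ∈ D₂ := by simpa using D₂.sub_mem hxy (h hy)
  exact joinSV_mem_orthogonal.2 ⟨h₂ hx,
    LinearMap.BilinForm.orthogonal_le h (h₂ (D₂.sub_mem (h hy) hx))⟩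

/-- The radical of the dual of a self-orthogonal space is the space itself. -/
theorem orthogonal_inf_orthogonal_orthogonal {D : Submodule (ZMod p) (SV F n)}
    (h : D ≤ (trSympForm p F n).orthogonal D) :
    (trSympForm p F n).orthogonal D ⊓
      (trSympForm p F n).orthogonal ((trSympForm p F n).orthogonal D) = D := by
  rw [LinearMap.BilinForm.orthogonal_orthogonal trSympForm_nondegenerate trSympForm_isAlt.isRefl,
    inf_eq_right.2 h]

/-- The minimum weight of the `(u | u + v)` construction. -/
theorem le_swt_of_mem_orthogonal_joinStabilizer {D₁ D₂ : Submodule (ZMod p) (SV F n)} {d : ℕ}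
    (h : D₁ ≤ D₂) (hd : ∀ v ∈ (trSympForm p F n).orthogonal D₁, v ≠ 0 → d ≤ swt v)
    {z : SV F (2 * n)}
    (hz : z ∈ (trSympForm p F (2 * n)).orthogonal (joinStabilizer D₁ D₂)) (hz0 : z ≠ 0) :
    d ≤ swt z := by
  obtain ⟨⟨x, y⟩, rfl⟩ := (joinSV p F n).surjective z
  obtain ⟨hx, hxy⟩ := joinSV_mem_orthogonal.1 hz
  rw [swt_joinSV]
  by_cases hv : y - x = 0
  · have hx0 : x ≠ 0 := by
      rintro rfl
      rw [sub_zero] at hv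
      exact hz0 (by rw [hv]; exact map_zero _)
    exact (hd x (LinearMap.BilinForm.orthogonal_le h hx) hx0).trans (Nat.le_add_right _ _)
  · have := hd _ hxy hv
    have := swt_sub_le y x
    omega

/-- A low-weight vector of the `(u | u + v)` dual that lies outside the stabilizer. -/
theorem exists_swt_le_notMem_joinStabilizer {W₁ W₂ D₁ D₂ E₁ E₂ : Submodule (ZMod p) (SV F n)}
    (hE₁ : (trSympForm p F n).orthogonal D₁ = E₁) (hE₂ : (trSympForm p F n).orthogonal D₂ = E₂)
    (hDW₁ : D₁ ≤ W₁) (hDW₂ : D₂ ≤ W₂) (hWE₁ : W₁ ≤ E₁) (hWE₂ : W₂ ≤ E₂)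
    (hW₁ : W₁ ≠ ⊥) (hD : D₁ ≤ D₂) {d₁ d₂ : ℕ}
    (hd₁ : d₁ = if E₁ = W₁ then swtSet (E₁ : Set (SV F n)) else swtSet ((E₁ : Set (SV F n)) \ W₁))
    (hp₁ : d₁ ≤ swtSet (E₁ : Set (SV F n)))
    (hd₂ : d₂ = if E₂ = W₂ then swtSet (E₂ : Set (SV F n)) else swtSet ((E₂ : Set (SV F n)) \ W₂))
    (hp₂ : d₂ ≤ swtSet (E₂ : Set (SV F n))) (hne : E₁ ≠ W₁ ∨ E₂ ≠ W₂) :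
    ∃ w ∈ (trSympForm p F (2 * n)).orthogonal (joinStabilizer D₁ D₂),
      w ∉ joinStabilizer D₁ D₂ ∧ swt w ≤ d₁ := by
  have hmem₁ : ∀ v ∈ E₁, joinSV p F n (0, v) ∈
      (trSympForm p F (2 * n)).orthogonal (joinStabilizer D₁ D₂) := fun v hv => by
    rw [joinSV_mem_orthogonal, sub_zero, hE₁]
    exact ⟨Submodule.zero_mem _, hv⟩
  by_cases h : ∃ v ∈ E₁, v ∉ D₁ ∧ swt v ≤ d₁
  · obtain ⟨v, hv, hvD, hvd⟩ := h
    exact ⟨_, hmem₁ v hv, fun h => hvD (joinSV_mem_joinStabilizer.1 h).2,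
      by rwa [swt_joinSV, swt_zero, zero_add]⟩
  push Not at h
  have hEW₁ : E₁ = W₁ := by
    by_contra hcon
    obtain ⟨v, hv, hvW, -, hvd⟩ := exists_swt_eq_of_pure hWE₁ hcon hd₁
    exact (h v hv fun hvD => hvW (hDW₁ hvD)).ne' hvd
  obtain ⟨u, hu, huW, -, hud⟩ :=
    exists_swt_eq_of_pure hWE₂ (hne.resolve_left (not_not.2 hEW₁)) hd₂
  obtain ⟨x, hx, hx0⟩ := W₁.ne_bot_iff.1 hW₁
  obtain ⟨v, hv, hv0, hvd⟩ := exists_swt_eq_swtSet (S := (E₁ : Set (SV F n))) ⟨x, hWE₁ hx, hx0⟩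
  have hvd₁ : swt v = d₁ := hvd.trans (eq_swtSet_of_pure hWE₁ hd₁ hp₁).symm
  have hvD : v ∈ D₁ := by
    by_contra hcon
    exact (h v hv hcon).ne' hvd₁
  have hd₂₁ : d₂ ≤ d₁ := hvd₁ ▸ hp₂.trans (swtSet_le (hWE₂ (hDW₂ (hD hvD))) hv0)
  have hE : E₂ ≤ E₁ := hE₁ ▸ hE₂ ▸ LinearMap.BilinForm.orthogonal_le hD
  refine ⟨joinSV p F n (u, 0), ?_, ?_, ?_⟩
  · rw [joinSV_mem_orthogonal, zero_sub, hE₁, hE₂]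
    exact ⟨hu, E₁.neg_mem (hE hu)⟩
  · rw [joinSV_mem_joinStabilizer, add_zero]
    exact fun h => huW (hDW₂ h.1)
  · rw [swt_joinSV, swt_zero, add_zero, hud]
    exact hd₂₁

theorem exists_pure_joined_code {k₁ r₁ d₁ k₂ r₂ d₂ : ℕ} (W₁ W₂ : Submodule (ZMod p) (SV F n))
    (h₁ : IsSubsystemCode p (Fintype.card F ^ k₁) (Fintype.card F ^ r₁) d₁ W₁.toAddSubgroup)
    (hp₁ : PureTo p d₁ W₁.toAddSubgroup)
    (h₂ : IsSubsystemCode p (Fintype.card F ^ k₂) (Fintype.card F ^ r₂) d₂ W₂.toAddSubgroup)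
    (hp₂ : PureTo p d₂ W₂.toAddSubgroup)
    (hsub : W₁ ⊓ (trSympForm p F n).orthogonal W₁ ≤ W₂ ⊓ (trSympForm p F n).orthogonal W₂) :
    ∃ (W : Submodule (ZMod p) (SV F (2 * n))) (d : ℕ), d₁ ≤ d ∧
      IsSubsystemCode p (Fintype.card F ^ (k₁ + k₂)) (Fintype.card F ^ (r₁ + r₂)) d
        W.toAddSubgroup ∧ PureTo p d W.toAddSubgroup := by
  obtain ⟨hW₁, hk₁, hr₁, hd₁⟩ := (isSubsystemCode_iff W₁).1 h₁
  obtain ⟨-, hk₂, hr₂, hd₂⟩ := (isSubsystemCode_iff W₂).1 h₂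
  rw [pureTo_iff] at hp₁ hp₂
  have hWE₁ := le_orthogonal_radical W₁
  have hWE₂ := le_orthogonal_radical W₂
  have hDW₁ : W₁ ⊓ (trSympForm p F n).orthogonal W₁ ≤ W₁ := inf_le_left
  have hDW₂ : W₂ ⊓ (trSympForm p F n).orthogonal W₂ ≤ W₂ := inf_le_left
  set D₁ := W₁ ⊓ (trSympForm p F n).orthogonal W₁
  set D₂ := W₂ ⊓ (trSympForm p F n).orthogonal W₂
  have hrank₁ := finrank_add_finrank_orthogonal_trSympForm D₁
  have hrank₂ := finrank_add_finrank_orthogonal_trSympForm D₂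
  have hrank := finrank_add_finrank_orthogonal_trSympForm (joinStabilizer D₁ D₂)
  have hself := joinStabilizer_le_orthogonal hsub (hDW₂.trans hWE₂)
  have hrad := orthogonal_inf_orthogonal_orthogonal hself
  rw [finrank_joinStabilizer] at hrank
  have hmin : ∀ z ∈ (trSympForm p F (2 * n)).orthogonal (joinStabilizer D₁ D₂), z ≠ 0 →
      d₁ ≤ swt z := fun z hz hz0 =>
    le_swt_of_mem_orthogonal_joinStabilizer hsub
      (fun v hv hv0 => hp₁.trans (swtSet_le hv hv0)) hz hz0
  have hwit := exists_swt_le_notMem_joinStabilizer rfl rfl hDW₁ hDW₂ hWE₁ hWE₂ hW₁ hsub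
    hd₁ hp₁ hd₂ hp₂
  obtain ⟨x, hx, hx0⟩ := W₁.ne_bot_iff.1 hW₁
  have hxE : joinSV p F n (0, x) ∈
      (trSympForm p F (2 * n)).orthogonal (joinStabilizer D₁ D₂) := by
    rw [joinSV_mem_orthogonal, sub_zero]
    exact ⟨Submodule.zero_mem _, hWE₁ hx⟩
  have hxE0 : joinSV p F n (0, x) ≠ 0 := by simpa using hx0
  set D := joinStabilizer D₁ D₂
  have hDrank : Module.finrank (ZMod p) D = _ := finrank_joinStabilizer D₁ D₂
  set E := (trSympForm p F (2 * n)).orthogonal D with hE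
  set e := Module.finrank (ZMod p) F with he
  have hW₁pos : 0 < Module.finrank (ZMod p) W₁ :=
    Nat.pos_of_ne_zero fun h => hW₁ (Submodule.finrank_eq_zero.1 h)
  have hek : e * (k₁ + k₂) = e * k₁ + e * k₂ := mul_add _ _ _
  have her : e * (r₁ + r₂) = e * r₁ + e * r₂ := mul_add _ _ _
  have hen : e * (2 * n) = 2 * (e * n) := by ring
  obtain ⟨W, -, hWrad, hWrank, hWwit⟩ : ∃ W ≤ E, W ⊓ (trSympForm p F (2 * n)).orthogonal W = D ∧
      Module.finrank (ZMod p) W + 2 * (e * (k₁ + k₂)) = Module.finrank (ZMod p) E ∧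
      (E ≠ W → ∃ w ∈ E, w ∉ W ∧ swt w ≤ d₁) := by
    by_cases hK : e * (k₁ + k₂) = 0
    · exact ⟨E, le_rfl, hrad, by omega, fun h => absurd rfl h⟩
    · obtain ⟨w, hwE, hwD, hwd⟩ := hwit (by
        by_contra! hcon
        rw [hcon.1] at hrank₁
        rw [hcon.2] at hrank₂
        omega)
      obtain ⟨W, hWE, hwW, hWrank, hWrad⟩ := exists_submodule_inf_orthogonal_eq
        (w := w) trSympForm_isAlt (hrad.symm ▸ hwD) (e * (k₁ + k₂))
        (by rw [hrad]; omega)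
      exact ⟨W, hWE, hWrad.trans hrad, hWrank,
        fun _ => ⟨w, hwE, hwW (Nat.pos_of_ne_zero hK), hwd⟩⟩
  obtain ⟨y, hy, hy0, hyd⟩ := exists_swt_eq_swtSet (S := (E : Set (SV F (2 * n)))) ⟨_, hxE, hxE0⟩
  have hd₁E : d₁ ≤ swtSet (E : Set (SV F (2 * n))) := hyd ▸ hmin y hy hy0
  have hbot : W ≠ ⊥ := by
    rintro rfl
    rw [finrank_bot] at hWrank
    omega
  refine ⟨W, _, ?_, (isSubsystemCode_iff W).2 ⟨hbot, ?_, ?_, rfl⟩, (pureTo_iff W).2 ?_⟩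
  all_goals rw [hWrad]
  · rw [← hE]
    split_ifs with hEW
    · exact hd₁E
    · obtain ⟨w, hwE, hwW, -⟩ := hWwit hEW
      obtain ⟨z, hz, hz0, hzd⟩ := exists_swt_eq_swtSet
        ⟨w, (Set.mem_sdiff _).2 ⟨hwE, hwW⟩, fun h => hwW (h ▸ W.zero_mem)⟩
      exact hzd ▸ hmin z hz.1 hz0
  · rw [← he]
    omega
  · rw [← he]
    omega
  · rw [← hE]
    split_ifs with hEW
    · exact le_rfl
    · obtain ⟨w, hwE, hwW, hwd⟩ := hWwit hEW
      exact (swtSet_le ((Set.mem_sdiff _).2 ⟨hwE, hwW⟩)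
        fun h => hwW (h ▸ W.zero_mem)).trans (hwd.trans hd₁E)

end TraceSymplectic


/-- Combining two pure `[[n,kᵢ,rᵢ,dᵢ]]_q` subsystem codes with `D₁ ⊆ D₂` gives a pure
`[[2n, k₁+k₂, r₁+r₂, d]]_q` subsystem code with `d ≥ min{d₁, 2d₂}`. -/
theorem stmt14 {p : ℕ} [Fact p.Prime] {F : Type} [Field F] [Fintype F] [CharP F p]
    {n k₁ r₁ d₁ k₂ r₂ d₂ : ℕ} (C₁ C₂ : AddSubgroup (SV F n))
    (h₁ : IsSubsystemCode p (Fintype.card F ^ k₁) (Fintype.card F ^ r₁) d₁ C₁)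
    (hp₁ : PureTo p d₁ C₁)
    (h₂ : IsSubsystemCode p (Fintype.card F ^ k₂) (Fintype.card F ^ r₂) d₂ C₂)
    (hp₂ : PureTo p d₂ C₂)
    (hsub : (C₁ : Set (SV F n)) ∩ sdual p (C₁ : Set (SV F n)) ⊆
      (C₂ : Set (SV F n)) ∩ sdual p (C₂ : Set (SV F n))) :
    ∃ (C : AddSubgroup (SV F (2 * n))) (d : ℕ), min d₁ (2 * d₂) ≤ d ∧
      IsSubsystemCode p (Fintype.card F ^ (k₁ + k₂)) (Fintype.card F ^ (r₁ + r₂)) d C ∧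
      PureTo p d C := by
  let := ZMod.algebra F p
  obtain ⟨W, d, hd, hcode, hpure⟩ := exists_pure_joined_code
    (AddSubgroup.toZModSubmodule p C₁) (AddSubgroup.toZModSubmodule p C₂) h₁ hp₁ h₂ hp₂
    (by rw [← SetLike.coe_subset_coe, coe_radical, coe_radical]; exact hsub)
  exact ⟨W.toAddSubgroup, d, (min_le_left _ _).trans hd, hcode, hpure⟩
end
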